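/- arXiv:1806.03745 — 2 statements merged into one kernel-verified Lean document; each statement's English description precedes it below -/
import Mathlib

section
/- Let μ, a ∈ ℝ and σ, b > 0, and let X be a random variable with law N(a, b²). Define the Gaussian CRPS c0(x) = x + 2σ·[φ((x−μ)/σ) − ((x−μ)/σ)·(1 − Φ((x−μ)/σ))] − (μ + σ/√π). Then E[c0(X)] = a + 2·[ (√(σ² + b²)/√(2π))·exp(−(a − μ)²/(2(σ² + b²))) − (a − μ)·(1 − Φ((a − μ)/√(σ² + b²))) ] − (μ + σ/√π), where φ and Φ denote the standard normal probability density function and cumulative distribution function. -/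
open MeasureTheory ProbabilityTheory Real

/-- The probability density function of the standard normal distribution. -/
noncomputable def stdNormalPDF (z : ℝ) : ℝ := (Real.sqrt (2 * π))⁻¹ * Real.exp (-z ^ 2 / 2)

/-- The cumulative distribution function of the standard normal distribution. -/
noncomputable def stdNormalCDF (z : ℝ) : ℝ := ∫ t in Set.Iic z, stdNormalPDF t

lemma stdNormalPDF_eq_gaussianPDFReal : stdNormalPDF = gaussianPDFReal 0 1 := by
  ext z
  simp [stdNormalPDF, gaussianPDFReal]

lemma integrable_stdNormalPDF : Integrable stdNormalPDF :=
  stdNormalPDF_eq_gaussianPDFReal ▸ integrable_gaussianPDFReal 0 1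

lemma integrable_mul_stdNormalPDF : Integrable fun z ↦ z * stdNormalPDF z := by
  convert (integrable_mul_exp_neg_mul_sq (b := 1 / 2) (by norm_num)).const_mul
    (Real.sqrt (2 * π))⁻¹ using 2 with z
  rw [stdNormalPDF, mul_left_comm]
  ring_nf

lemma one_sub_stdNormalCDF (z : ℝ) :
    1 - stdNormalCDF z = ∫ t in Set.Ioi z, stdNormalPDF t := by
  have h := integral_add_compl (measurableSet_Iic (a := z)) integrable_stdNormalPDF
  rw [Set.compl_Iic, stdNormalPDF_eq_gaussianPDFReal,
    integral_gaussianPDFReal_eq_one 0 one_ne_zero] at h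
  rw [stdNormalCDF, stdNormalPDF_eq_gaussianPDFReal]
  linarith

lemma integral_Ioi_mul_stdNormalPDF (z : ℝ) :
    ∫ t in Set.Ioi z, t * stdNormalPDF t = stdNormalPDF z := by
  have hd (t : ℝ) : HasDerivAt (fun t ↦ -stdNormalPDF t) (t * stdNormalPDF t) t := by
    have h : HasDerivAt (fun t : ℝ ↦ -t ^ 2 / 2) (-t) t := by
      refine ((hasDerivAt_pow 2 t).neg.div_const 2).congr_deriv ?_
      norm_num
      ring
    refine (h.exp.const_mul (Real.sqrt (2 * π))⁻¹).neg.congr_deriv ?_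
    rw [stdNormalPDF]
    ring
  have hlim : Filter.Tendsto (fun t ↦ -stdNormalPDF t) Filter.atTop (nhds 0) := by
    refine tendsto_zero_of_hasDerivAt_of_integrableOn_Ioi (a := z) (fun t _ ↦ hd t)
      integrable_mul_stdNormalPDF.integrableOn integrable_stdNormalPDF.neg.integrableOn
  rw [integral_Ioi_of_hasDerivAt_of_tendsto' (fun t _ ↦ hd t)
    integrable_mul_stdNormalPDF.integrableOn hlim]
  ring

/-- The expected positive part of `Z - z` for a standard normal variable `Z`. -/
lemma integral_max_sub_gaussianReal_zero_one (z : ℝ) :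
    ∫ t, max (t - z) 0 ∂gaussianReal 0 1 = stdNormalPDF z - z * (1 - stdNormalCDF z) := by
  rw [integral_gaussianReal_eq_integral_smul one_ne_zero, ← stdNormalPDF_eq_gaussianPDFReal]
  have h : (fun t ↦ stdNormalPDF t • max (t - z) 0)
      = (Set.Ioi z).indicator fun t ↦ t * stdNormalPDF t - z * stdNormalPDF t := by
    ext t
    by_cases ht : z < t
    · rw [Set.indicator_of_mem (Set.mem_Ioi.2 ht), max_eq_left (by linarith), smul_eq_mul]
      ring
    · rw [Set.indicator_of_notMem (by simpa using ht), max_eq_right (by linarith), smul_zero]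
  rw [h, integral_indicator measurableSet_Ioi,
    integral_sub integrable_mul_stdNormalPDF.integrableOn
      (integrable_stdNormalPDF.const_mul z).integrableOn,
    integral_const_mul, integral_Ioi_mul_stdNormalPDF, one_sub_stdNormalCDF]

/-- The expected positive part of `Y - x` for a Gaussian variable `Y`. -/
lemma integral_max_sub_gaussianReal (m x : ℝ) {s : ℝ} {v : NNReal} (hs : 0 < s)
    (hv : (v : ℝ) = s ^ 2) :
    ∫ y, max (y - x) 0 ∂gaussianReal m v
      = s * (stdNormalPDF ((x - m) / s)
        - (x - m) / s * (1 - stdNormalCDF ((x - m) / s))) := by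
  have hmap : (gaussianReal 0 1).map (fun t ↦ m + s * t) = gaussianReal m v := by
    have h : (fun t ↦ m + s * t) = (m + ·) ∘ (s * ·) := rfl
    rw [h, ← Measure.map_map (by fun_prop) (by fun_prop), gaussianReal_map_const_mul,
      gaussianReal_map_const_add, mul_zero, zero_add, mul_one]
    congr 1
    exact NNReal.eq hv.symm
  rw [← hmap, integral_map (by fun_prop) (by fun_prop),
    ← integral_max_sub_gaussianReal_zero_one, ← integral_const_mul]
  congr with t
  rw [mul_max_of_nonneg _ _ hs.le, mul_zero]
  congr 1
  field_simp
  ring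

lemma integrable_id_gaussianReal (m : ℝ) (v : NNReal) :
    Integrable (fun x ↦ x) (gaussianReal m v) :=
  memLp_one_iff_integrable.1 (memLp_id_gaussianReal 1)

lemma integrable_max_sub_gaussianReal_prod (m₁ m₂ : ℝ) (v₁ v₂ : NNReal) :
    Integrable (fun p : ℝ × ℝ ↦ max (p.2 - p.1) 0)
      ((gaussianReal m₁ v₁).prod (gaussianReal m₂ v₂)) :=
  (((integrable_id_gaussianReal m₂ v₂).comp_snd _).sub
    ((integrable_id_gaussianReal m₁ v₁).comp_fst _)).pos_part

/-- The difference of independent Gaussian variables is Gaussian, at the level of the expected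
positive part. -/
lemma integral_integral_max_sub_gaussianReal (m₁ m₂ : ℝ) (v₁ v₂ : NNReal) :
    ∫ x, ∫ y, max (y - x) 0 ∂gaussianReal m₂ v₂ ∂gaussianReal m₁ v₁
      = ∫ w, max w 0 ∂gaussianReal (m₂ - m₁) (v₂ + v₁) := by
  have hconv : gaussianReal (m₂ - m₁) (v₂ + v₁)
      = Measure.conv (gaussianReal (-m₁) v₁) (gaussianReal m₂ v₂) := by
    rw [gaussianReal_conv_gaussianReal, add_comm v₂, neg_add_eq_sub]
  have hint := (integrable_id_gaussianReal (m₂ - m₁) (v₂ + v₁)).pos_part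
  rw [hconv] at hint ⊢
  rw [integral_conv hint, ← gaussianReal_map_neg, integral_map (by fun_prop)]
  · simp_rw [neg_add_eq_sub]
  · refine StronglyMeasurable.aestronglyMeasurable ?_
    refine StronglyMeasurable.integral_prod_right (f := fun x y : ℝ ↦ max (x + y) 0) ?_
    exact Continuous.stronglyMeasurable (by fun_prop)

/-- Expected Gaussian CRPS `c0` (forecast `N(μ, σ²)`) when the evaluation point
follows `N(a, b²)`. -/
theorem stmt9 {Ω : Type*} [MeasurableSpace Ω] (P : Measure Ω) [IsProbabilityMeasure P]
    (X : Ω → ℝ) (μ a σ b : ℝ) (hσ : 0 < σ) (hb : 0 < b)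
    (hX : P.map X = gaussianReal a ⟨b ^ 2, sq_nonneg b⟩)
    (c0 : ℝ → ℝ)
    (hc0 : c0 = fun x => x + 2 * σ * (stdNormalPDF ((x - μ) / σ)
        - ((x - μ) / σ) * (1 - stdNormalCDF ((x - μ) / σ))) - (μ + σ / Real.sqrt π)) :
    ∫ ω, c0 (X ω) ∂P
      = a + 2 * ((Real.sqrt (σ ^ 2 + b ^ 2) / Real.sqrt (2 * π))
            * Real.exp (-(a - μ) ^ 2 / (2 * (σ ^ 2 + b ^ 2)))
          - (a - μ) * (1 - stdNormalCDF ((a - μ) / Real.sqrt (σ ^ 2 + b ^ 2))))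
        - (μ + σ / Real.sqrt π) := by
  obtain ⟨v, hv⟩ : ∃ v : NNReal, (v : ℝ) = σ ^ 2 := ⟨⟨σ ^ 2, sq_nonneg σ⟩, rfl⟩
  obtain ⟨w, hw, hX⟩ : ∃ w : NNReal, (w : ℝ) = b ^ 2 ∧ P.map X = gaussianReal a w :=
    ⟨⟨b ^ 2, sq_nonneg b⟩, rfl, hX⟩
  have hXm : AEMeasurable X P := by
    apply AEMeasurable.of_map_ne_zero
    simp [NeZero.ne, hX]
  have hc : c0 = fun x ↦ x + 2 * (∫ y, max (y - x) 0 ∂gaussianReal μ v)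
      - (μ + σ / Real.sqrt π) := by
    ext x
    rw [hc0, integral_max_sub_gaussianReal μ x hσ hv]
    ring
  have hI : Integrable (fun x ↦ 2 * ∫ y, max (y - x) 0 ∂gaussianReal μ v) (gaussianReal a w) :=
    (integrable_max_sub_gaussianReal_prod a μ w v).integral_prod_left.const_mul 2
  have hid := integrable_id_gaussianReal a w
  have hadd : Integrable (fun x ↦ x + 2 * ∫ y, max (y - x) 0 ∂gaussianReal μ v)
      (gaussianReal a w) := hid.add hI
  have hs : 0 < Real.sqrt (σ ^ 2 + b ^ 2) := by positivity
  have hvar : ((v + w : NNReal) : ℝ) = Real.sqrt (σ ^ 2 + b ^ 2) ^ 2 := by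
    rw [Real.sq_sqrt (by positivity), NNReal.coe_add, hv, hw]
  have hD := integral_max_sub_gaussianReal (μ - a) 0 hs hvar
  simp only [sub_zero, zero_sub, neg_sub] at hD
  have hE : ∫ x, c0 x ∂gaussianReal a w
      = a + 2 * (∫ y, max y 0 ∂gaussianReal (μ - a) (v + w))
        - (μ + σ / Real.sqrt π) := by
    simp only [hc]
    rw [integral_sub hadd (integrable_const _), integral_add hid hI, integral_const_mul,
      integral_integral_max_sub_gaussianReal, integral_id_gaussianReal]
    simp
  have hmeas : AEStronglyMeasurable c0 (P.map X) := by
    rw [hX, hc]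
    exact (hadd.sub (integrable_const _)).aestronglyMeasurable
  rw [← integral_map hXm hmeas, hX, hE, hD, mul_sub, ← mul_assoc _ ((a - μ) / _),
    mul_div_cancel₀ _ hs.ne', stdNormalPDF, div_pow, Real.sq_sqrt (by positivity)]
  congr 4
  rw [div_eq_mul_inv (Real.sqrt _), mul_assoc]
  congr 3
  field_simp
end

section
/- Let α, β > 0 and let Z and Z' be independent random variables each following the gamma distribution with shape α and rate β (density β^α/Γ(α)·x^{α−1}·exp(−β·x) on (0,∞)). Then (1/2)·E|Z − Z'| = 1/(β·B(1/2, α)), where B(p, q) = Γ(p)Γ(q)/Γ(p+q) is the Beta function. -/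
open MeasureTheory ProbabilityTheory Real

/-- The gamma density on the positive half-line. -/
noncomputable def gammaDensity (a r x : ℝ) : ℝ :=
  r ^ a / Real.Gamma a * x ^ (a - 1) * exp (-(r * x))

lemma measurable_gammaDensity (a r : ℝ) : Measurable (gammaDensity a r) := by
  unfold gammaDensity
  fun_prop

lemma gammaDensity_nonneg {a r x : ℝ} (ha : 0 < a) (hr : 0 < r) (hx : 0 < x) :
    0 ≤ gammaDensity a r x := by
  unfold gammaDensity
  have := Real.Gamma_pos_of_pos ha
  positivity

lemma gammaMeasure_eq_withDensity_restrict (a r : ℝ) :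
    gammaMeasure a r =
      (volume.restrict (Set.Ioi 0)).withDensity fun x => ENNReal.ofReal (gammaDensity a r x) := by
  rw [gammaMeasure, ← withDensity_indicator measurableSet_Ioi]
  refine withDensity_congr_ae ?_
  filter_upwards [Measure.ae_ne volume (0 : ℝ)] with x hx
  rcases lt_or_gt_of_ne hx with h | h
  · rw [gammaPDF_of_neg h, Set.indicator_of_notMem (by simpa using h.le)]
  · rw [gammaPDF_of_nonneg h.le, Set.indicator_of_mem (by simpa using h), gammaDensity]

lemma setIntegral_gammaMeasure {a r : ℝ} (ha : 0 < a) (hr : 0 < r) {s : Set ℝ}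
    (hs : MeasurableSet s) (f : ℝ → ℝ) :
    ∫ x in s, f x ∂gammaMeasure a r = ∫ x in s ∩ Set.Ioi 0, gammaDensity a r x * f x := by
  rw [gammaMeasure_eq_withDensity_restrict, restrict_withDensity hs,
    integral_withDensity_eq_integral_toReal_smul (measurable_gammaDensity a r).ennreal_ofReal
      (by simp), Measure.restrict_restrict hs]
  refine setIntegral_congr_fun (hs.inter measurableSet_Ioi) fun x hx => ?_
  simp [ENNReal.toReal_ofReal (gammaDensity_nonneg ha hr hx.2)]

lemma integral_gammaMeasure {a r : ℝ} (ha : 0 < a) (hr : 0 < r) (f : ℝ → ℝ) :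
    ∫ x, f x ∂gammaMeasure a r = ∫ x in Set.Ioi 0, gammaDensity a r x * f x := by
  simpa using setIntegral_gammaMeasure ha hr MeasurableSet.univ f

lemma integrable_gammaMeasure_iff {a r : ℝ} (ha : 0 < a) (hr : 0 < r) (f : ℝ → ℝ) :
    Integrable f (gammaMeasure a r) ↔
      IntegrableOn (fun x => gammaDensity a r x * f x) (Set.Ioi 0) := by
  rw [gammaMeasure_eq_withDensity_restrict,
    integrable_withDensity_iff (measurable_gammaDensity a r).ennreal_ofReal (by simp)]
  refine integrableOn_congr_fun (fun x hx => ?_) measurableSet_Ioi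
  simp [ENNReal.toReal_ofReal (gammaDensity_nonneg ha hr hx), mul_comm]

lemma gammaDensity_mul_self {a r x : ℝ} (hx : 0 < x) :
    gammaDensity a r x * x = r ^ a / Real.Gamma a * (x ^ a * exp (-r * x)) := by
  have : x ^ a = x ^ (a - 1) * x := by rw [← rpow_add_one hx.ne', sub_add_cancel]
  rw [gammaDensity, this, neg_mul]
  ring

lemma integrable_id_gammaMeasure {a r : ℝ} (ha : 0 < a) (hr : 0 < r) :
    Integrable (fun x => x) (gammaMeasure a r) := by
  rw [integrable_gammaMeasure_iff ha hr]
  have h := (integrableOn_rpow_mul_exp_neg_mul_rpow (p := 1) (s := a) (b := r)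
    (by linarith) one_pos hr).const_mul (r ^ a / Real.Gamma a)
  refine IntegrableOn.congr_fun h (fun x hx => ?_) measurableSet_Ioi
  simp [gammaDensity_mul_self hx]

lemma integral_Ioi_gammaDensity_mul_sub {a r y : ℝ} (ha : 0 < a) (hr : 0 < r) (hy : 0 ≤ y) :
    ∫ x in Set.Ioi y, gammaDensity a r x * (x - a / r) =
      r ^ a / Real.Gamma a / r * (y ^ a * exp (-r * y)) := by
  have := isProbabilityMeasure_gammaMeasure ha hr
  have hint : IntegrableOn (fun x => gammaDensity a r x * (x - a / r)) (Set.Ioi y) :=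
    ((integrable_gammaMeasure_iff ha hr _).1
      ((integrable_id_gammaMeasure ha hr).sub (integrable_const _))).mono_set
      (Set.Ioi_subset_Ioi hy)
  rw [integral_Ioi_of_hasDerivAt_of_tendsto (m := 0)
    (f := fun x => -(r ^ a / Real.Gamma a / r * (x ^ a * exp (-r * x)))) ?_ ?_ hint ?_]
  · ring
  · have : Continuous fun x : ℝ => x ^ a := continuous_rpow_const ha.le
    exact Continuous.continuousWithinAt (by fun_prop)
  · intro x hx
    have hx0 : 0 < x := hy.trans_lt hx
    have h1 := Real.hasDerivAt_rpow_const (p := a) (Or.inl hx0.ne')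
    have h2 : HasDerivAt (fun x => exp (-r * x)) (exp (-r * x) * (-r)) x := by
      simpa using ((hasDerivAt_id x).const_mul (-r)).exp
    refine (((h1.mul h2).const_mul (r ^ a / Real.Gamma a / r)).neg).congr_deriv ?_
    rw [mul_sub, gammaDensity_mul_self hx0, gammaDensity, neg_mul]
    field_simp
    ring
  · simpa using ((tendsto_rpow_mul_exp_neg_mul_atTop_nhds_zero a r hr).const_mul
      (r ^ a / Real.Gamma a / r)).neg

lemma integral_gammaDensity_mul_rpow {a r : ℝ} (ha : 0 < a) (hr : 0 < r) :
    ∫ y in Set.Ioi 0,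
      gammaDensity a r y * (2 * (r ^ a / Real.Gamma a / r * (y ^ a * exp (-r * y)))) =
      1 / r * (Real.Gamma (a + 1 / 2) / (Real.Gamma a * √π)) := by
  have hG := Real.Gamma_pos_of_pos ha
  have h : ∀ y ∈ Set.Ioi (0 : ℝ),
      gammaDensity a r y * (2 * (r ^ a / Real.Gamma a / r * (y ^ a * exp (-r * y)))) =
      2 / r * (r ^ a / Real.Gamma a) ^ 2 * (y ^ (2 * a - 1) * exp (-((2 * r) * y))) := by
    intro y hy
    have h1 : y ^ (2 * a - 1) = y ^ (a - 1) * y ^ a := by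
      rw [← rpow_add hy]; ring_nf
    have h2 : exp (-((2 * r) * y)) = exp (-(r * y)) * exp (-r * y) := by
      rw [← exp_add]; ring_nf
    rw [h1, h2, gammaDensity]
    ring
  rw [setIntegral_congr_fun measurableSet_Ioi h, integral_const_mul,
    integral_rpow_mul_exp_neg_mul_Ioi (by positivity) (by positivity)]
  have hd := Real.Gamma_mul_Gamma_add_half a
  have h2 : (1 / (2 * r)) ^ (2 * a) = (2 ^ (1 - 2 * a) / 2) / (r ^ a) ^ 2 := by
    rw [one_div, inv_rpow (by positivity), mul_rpow (by norm_num) hr.le,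
      rpow_sub (by norm_num), rpow_one, ← rpow_natCast (r ^ a), ← rpow_mul hr.le]
    push_cast
    rw [mul_comm a 2]
    field_simp
  have hpi : √π ≠ 0 := by positivity
  have hra : r ^ a ≠ 0 := by positivity
  rw [h2]
  have h3 : Real.Gamma (a + 1 / 2) =
      Real.Gamma (2 * a) * 2 ^ (1 - 2 * a) * √π / Real.Gamma a := by
    rw [← hd]; field_simp
  rw [h3]
  field_simp

/-- The mean absolute difference of two independent gamma variables, as a double integral. -/
lemma integral_abs_sub_gammaMeasure_prod {a r : ℝ} (ha : 0 < a) (hr : 0 < r) :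
    ∫ z, |z.1 - z.2| ∂(gammaMeasure a r).prod (gammaMeasure a r) =
      2 / r * (Real.Gamma (a + 1 / 2) / (Real.Gamma a * √π)) := by
  have := isProbabilityMeasure_gammaMeasure ha hr
  set μ := gammaMeasure a r
  set f : ℝ → ℝ := fun x => x - a / r with hf
  set A : Set (ℝ × ℝ) := {z | z.2 < z.1}
  set B : Set (ℝ × ℝ) := {z | z.2 ≤ z.1}
  have hA : MeasurableSet A := measurableSet_lt measurable_snd measurable_fst
  have hB : MeasurableSet B := measurableSet_le measurable_snd measurable_fst
  set h : ℝ × ℝ → ℝ := fun z =>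
    A.indicator (fun z => f z.1) z + B.indicator (fun z => f z.1) z - f z.1 with hh
  have hfi : Integrable f μ := (integrable_id_gammaMeasure ha hr).sub (integrable_const _)
  have hfp : Integrable (fun z : ℝ × ℝ => f z.1) (μ.prod μ) := hfi.comp_fst μ
  have hi : Integrable h (μ.prod μ) := ((hfp.indicator hA).add (hfp.indicator hB)).sub hfp
  have habs : ∀ z : ℝ × ℝ, |z.1 - z.2| = h z + h z.swap := by
    rintro ⟨x, y⟩
    rcases lt_trichotomy x y with hxy | hxy | hxy
    · simp [hh, A, B, Set.indicator, hxy, hxy.le, hxy.not_gt, hxy.not_ge, hf,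
        abs_of_neg (sub_neg.2 hxy)]
    · simp [hh, A, B, Set.indicator, hxy]
    · simp [hh, A, B, Set.indicator, hxy, hxy.le, hxy.not_gt, hxy.not_ge, hf,
        abs_of_pos (sub_pos.2 hxy)]
  have h0 : ∫ x, f x ∂μ = 0 := by
    rw [integral_gammaMeasure ha hr, integral_Ioi_gammaDensity_mul_sub ha hr le_rfl,
      zero_rpow ha.ne']
    simp
  have hinner : ∀ y ∈ Set.Ioi (0 : ℝ), ∫ x, h (x, y) ∂μ =
      2 * (r ^ a / Real.Gamma a / r * (y ^ a * exp (-r * y))) := by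
    intro y hy
    have e : ∀ x, h (x, y) =
        (Set.Ioi y).indicator f x + (Set.Ici y).indicator f x - f x := fun x => rfl
    simp_rw [e]
    have i1 : Integrable ((Set.Ioi y).indicator f) μ := hfi.indicator measurableSet_Ioi
    have i2 : Integrable ((Set.Ici y).indicator f) μ := hfi.indicator measurableSet_Ici
    rw [integral_sub (f := fun x => (Set.Ioi y).indicator f x + (Set.Ici y).indicator f x)
      (i1.add i2) hfi, integral_add i1 i2, h0,
      integral_indicator measurableSet_Ioi, integral_indicator measurableSet_Ici,
      setIntegral_gammaMeasure ha hr measurableSet_Ioi,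
      setIntegral_gammaMeasure ha hr measurableSet_Ici,
      Set.inter_eq_left.2 (Set.Ioi_subset_Ioi (le_of_lt hy)),
      Set.inter_eq_left.2 (Set.Ici_subset_Ioi.2 hy), integral_Ici_eq_integral_Ioi,
      integral_Ioi_gammaDensity_mul_sub ha hr (le_of_lt hy)]
    ring
  have hval : ∫ z, h z ∂μ.prod μ =
      1 / r * (Real.Gamma (a + 1 / 2) / (Real.Gamma a * √π)) := by
    rw [integral_prod_symm _ hi, integral_gammaMeasure ha hr,
      ← integral_gammaDensity_mul_rpow ha hr]
    exact setIntegral_congr_fun measurableSet_Ioi fun y hy => by simp only [hinner y hy]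
  simp_rw [habs]
  rw [integral_add (g := fun z : ℝ × ℝ => h z.swap) hi hi.swap, integral_prod_swap h, hval]
  ring

/-- For `Z, Z'` independent gamma random variables with shape `α` and rate `β`,
`(1/2)·E|Z − Z'| = 1/(β·B(1/2, α))`, where `B(p,q) = Γ(p)Γ(q)/Γ(p+q)` is the Beta
function. -/
theorem stmt18 {Ω : Type*} [MeasurableSpace Ω] (P : Measure Ω) [IsProbabilityMeasure P]
    (Z Z' : Ω → ℝ) (α β : ℝ) (hα : 0 < α) (hβ : 0 < β)
    (hZ : P.map Z = gammaMeasure α β) (hZ' : P.map Z' = gammaMeasure α β)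
    (hindep : IndepFun Z Z' P)
    (B : ℝ → ℝ → ℝ)
    (hB : B = fun p q => Real.Gamma p * Real.Gamma q / Real.Gamma (p + q)) :
    (1 / 2) * ∫ ω, |Z ω - Z' ω| ∂P = 1 / (β * B (1 / 2) α) := by
  have := isProbabilityMeasure_gammaMeasure hα hβ
  have hmZ : AEMeasurable Z P := by
    by_contra h
    exact IsProbabilityMeasure.ne_zero (gammaMeasure α β) (hZ ▸ Measure.map_of_not_aemeasurable h)
  have hmZ' : AEMeasurable Z' P := by
    by_contra h
    exact IsProbabilityMeasure.ne_zero (gammaMeasure α β) (hZ' ▸ Measure.map_of_not_aemeasurable h)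
  have hprod := (indepFun_iff_map_prod_eq_prod_map_map hmZ hmZ').1 hindep
  rw [hZ, hZ'] at hprod
  have hmap : ∫ ω, |Z ω - Z' ω| ∂P =
      ∫ z, |z.1 - z.2| ∂(gammaMeasure α β).prod (gammaMeasure α β) := by
    rw [← hprod, integral_map (hmZ.prodMk hmZ')
      (Measurable.aestronglyMeasurable (by fun_prop))]
  have h1 := Real.Gamma_pos_of_pos hα
  have h2 := Real.Gamma_pos_of_pos (show 0 < α + 1 / 2 by positivity)
  rw [hmap, integral_abs_sub_gammaMeasure_prod hα hβ, hB]
  simp only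
  rw [Real.Gamma_one_half_eq, add_comm (1 / 2) α]
  field_simp
end
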